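/- arXiv:2308.09527 — 7 statements merged into one kernel-verified Lean document; each statement's English description precedes it below -/
import Mathlib

section
/- Under the pre-treatment factor model with synthetic-control weights α satisfying Γα = β, the mean of the untreated potential outcome is identified by the donor outcomes: E[Y0] = E[⟪W, α⟫]. -/
open MeasureTheory Matrix

/-- A function whose conditional expectation vanishes almost everywhere has integral zero. -/
theorem integral_eq_zero_of_condExp_ae_eq_zero {Ω : Type*} {m m₀ : MeasurableSpace Ω}
    {μ : Measure Ω} (hm : m ≤ m₀) [SigmaFinite (μ.trim hm)] {f : Ω → ℝ}
    (hf : μ[f | m] =ᵐ[μ] 0) : ∫ ω, f ω ∂μ = 0 := by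
  rw [← integral_condExp hm, integral_congr_ae hf]
  simp

/-- Under the pre-treatment factor model with synthetic-control weights α
satisfying Γα = β, the mean of the untreated potential outcome is identified by the donor
outcomes: E[Y0] = E[⟪W, α⟫]. -/
theorem sc_identification_Y0
    {Ω : Type*} [MeasurableSpace Ω] (P : Measure Ω) [IsProbabilityMeasure P]
    {F N : ℕ}
    (lam : Ω → Fin F → ℝ) (β : Fin F → ℝ) (Γ : Matrix (Fin F) (Fin N) ℝ)
    (Y0 : Ω → ℝ) (W : Ω → Fin N → ℝ) (εY : Ω → ℝ) (εW : Ω → Fin N → ℝ)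
    (hlam : Measurable lam)
    (hY0 : ∀ ω, Y0 ω = lam ω ⬝ᵥ β + εY ω)
    (hW : ∀ ω, W ω = Γ.transpose.mulVec (lam ω) + εW ω)
    (hεY : P[εY | MeasurableSpace.comap lam inferInstance] =ᵐ[P] 0)
    (hεW : ∀ i, P[(fun ω => εW ω i) | MeasurableSpace.comap lam inferInstance] =ᵐ[P] 0)
    (hY0int : Integrable Y0 P) (hεYint : Integrable εY P)
    (hlamint : ∀ i, Integrable (fun ω => lam ω i) P)
    (hWint : ∀ i, Integrable (fun ω => W ω i) P)
    (hεWint : ∀ i, Integrable (fun ω => εW ω i) P)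
    (α : Fin N → ℝ) (hα : Γ.mulVec α = β) :
    ∫ ω, Y0 ω ∂P = ∫ ω, W ω ⬝ᵥ α ∂P := by
  have hm := hlam.comap_le
  have hW_dot : ∀ ω, W ω ⬝ᵥ α = lam ω ⬝ᵥ β + εW ω ⬝ᵥ α := fun ω => by
    rw [hW, add_dotProduct, mulVec_transpose, ← dotProduct_mulVec, hα]
  have hlam_dot : Integrable (fun ω => lam ω ⬝ᵥ β) P :=
    integrable_finsetSum _ fun i _ => (hlamint i).mul_const (β i)
  have hεW_dot : Integrable (fun ω => εW ω ⬝ᵥ α) P :=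
    integrable_finsetSum _ fun i _ => (hεWint i).mul_const (α i)
  have hεW_zero : ∫ ω, εW ω ⬝ᵥ α ∂P = 0 := by
    simp only [dotProduct]
    rw [integral_finsetSum _ fun i _ => (hεWint i).mul_const (α i)]
    simp [integral_mul_const, fun i => integral_eq_zero_of_condExp_ae_eq_zero hm (hεW i)]
  simp_rw [hY0, hW_dot]
  rw [integral_add hlam_dot hεYint, integral_add hlam_dot hεW_dot, hεW_zero,
    integral_eq_zero_of_condExp_ae_eq_zero hm hεY]
end

section
/- Under the pre-treatment factor model and the post-treatment surrogate factor model with Γα = β and Φγ = θ, the post-treatment residual has zero conditional mean given the latent factors: E[Y1 − ⟪W, α⟫ − ⟪X, γ⟫ | σ(λ, ρ)] = 0 almost surely. -/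
open MeasureTheory Matrix

theorem integrable_dotProduct_const {Ω ι : Type*} [Fintype ι] [MeasurableSpace Ω]
    {P : Measure Ω} {ε : Ω → ι → ℝ} (hint : ∀ i, Integrable (fun ω => ε ω i) P) (a : ι → ℝ) :
    Integrable (fun ω => ε ω ⬝ᵥ a) P :=
  integrable_finsetSum _ fun i _ => (hint i).mul_const (a i)

theorem condExp_dotProduct_const_eq_zero {Ω ι : Type*} [Fintype ι] {m m₀ : MeasurableSpace Ω}
    {P : Measure Ω} {ε : Ω → ι → ℝ} (hint : ∀ i, Integrable (fun ω => ε ω i) P)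
    (hzero : ∀ i, P[(fun ω => ε ω i) | m] =ᵐ[P] 0) (a : ι → ℝ) :
    P[(fun ω => ε ω ⬝ᵥ a) | m] =ᵐ[P] 0 := by
  have hsum : (fun ω => ε ω ⬝ᵥ a) = ∑ i, a i • fun ω => ε ω i := by
    ext ω
    simp [dotProduct, mul_comm]
  rw [hsum]
  refine (condExp_finsetSum (fun i _ => (hint i).smul (a i)) m).trans ?_
  have hall : ∀ᵐ ω ∂P, ∀ i, (P[a i • (fun ω => ε ω i) | m]) ω = 0 := by
    refine ae_all_iff.2 fun i => ?_
    filter_upwards [condExp_smul (μ := P) (a i) (fun ω => ε ω i) m, hzero i] with ω h₁ h₂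
    simp [h₁, h₂]
  filter_upwards [hall] with ω h
  simp [h]

/-- Under the pre-treatment factor model and the post-treatment surrogate factor
model with Γα = β and Φγ = θ, the post-treatment residual has zero conditional mean given the
latent factors: E[Y1 − ⟪W, α⟫ − ⟪X, γ⟫ | σ(λ, ρ)] = 0 almost surely. -/
theorem sc_post_residual_cond_mean_zero
    {Ω : Type*} [MeasurableSpace Ω] (P : Measure Ω) [IsProbabilityMeasure P]
    {F N K H : ℕ}
    (lam : Ω → Fin F → ℝ) (β : Fin F → ℝ) (Γ : Matrix (Fin F) (Fin N) ℝ)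
    (rho : Ω → Fin K → ℝ) (θ : Fin K → ℝ) (Φ : Matrix (Fin K) (Fin H) ℝ)
    (Y0 Y1 : Ω → ℝ) (W : Ω → Fin N → ℝ) (X : Ω → Fin H → ℝ)
    (εY : Ω → ℝ) (εW : Ω → Fin N → ℝ) (δ : Ω → ℝ) (εX : Ω → Fin H → ℝ)
    (hlam : Measurable lam) (hrho : Measurable rho)
    (hY0 : ∀ ω, Y0 ω = lam ω ⬝ᵥ β + εY ω)
    (hW : ∀ ω, W ω = Γ.transpose.mulVec (lam ω) + εW ω)
    (hY1 : ∀ ω, Y1 ω - Y0 ω = rho ω ⬝ᵥ θ + δ ω)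
    (hX : ∀ ω, X ω = Φ.transpose.mulVec (rho ω) + εX ω)
    (hεY : P[εY | MeasurableSpace.comap (fun ω => (lam ω, rho ω)) inferInstance] =ᵐ[P] 0)
    (hεW : ∀ i, P[(fun ω => εW ω i) |
      MeasurableSpace.comap (fun ω => (lam ω, rho ω)) inferInstance] =ᵐ[P] 0)
    (hδ : P[δ | MeasurableSpace.comap (fun ω => (lam ω, rho ω)) inferInstance] =ᵐ[P] 0)
    (hεX : ∀ i, P[(fun ω => εX ω i) |
      MeasurableSpace.comap (fun ω => (lam ω, rho ω)) inferInstance] =ᵐ[P] 0)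
    (hY0int : Integrable Y0 P) (hY1int : Integrable Y1 P)
    (hεYint : Integrable εY P) (hδint : Integrable δ P)
    (hlamint : ∀ i, Integrable (fun ω => lam ω i) P)
    (hrhoint : ∀ i, Integrable (fun ω => rho ω i) P)
    (hWint : ∀ i, Integrable (fun ω => W ω i) P)
    (hXint : ∀ i, Integrable (fun ω => X ω i) P)
    (hεWint : ∀ i, Integrable (fun ω => εW ω i) P)
    (hεXint : ∀ i, Integrable (fun ω => εX ω i) P)
    (α : Fin N → ℝ) (hα : Γ.mulVec α = β)
    (γ : Fin H → ℝ) (hγ : Φ.mulVec γ = θ) :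
    P[(fun ω => Y1 ω - W ω ⬝ᵥ α - X ω ⬝ᵥ γ) |
      MeasurableSpace.comap (fun ω => (lam ω, rho ω)) inferInstance] =ᵐ[P] 0 := by
  have hres : (fun ω => Y1 ω - W ω ⬝ᵥ α - X ω ⬝ᵥ γ) =
      εY + δ - (fun ω => εW ω ⬝ᵥ α) - (fun ω => εX ω ⬝ᵥ γ) := by
    ext ω
    have hWα : W ω ⬝ᵥ α = lam ω ⬝ᵥ β + εW ω ⬝ᵥ α := by
      rw [hW, add_dotProduct, mulVec_transpose, ← dotProduct_mulVec, hα]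
    have hXγ : X ω ⬝ᵥ γ = rho ω ⬝ᵥ θ + εX ω ⬝ᵥ γ := by
      rw [hX, add_dotProduct, mulVec_transpose, ← dotProduct_mulVec, hγ]
    simp only [Pi.add_apply, Pi.sub_apply]
    linarith [hY0 ω, hY1 ω]
  have hWα := integrable_dotProduct_const hεWint α
  have hXγ := integrable_dotProduct_const hεXint γ
  rw [hres]
  generalize MeasurableSpace.comap (fun ω => (lam ω, rho ω)) inferInstance = m at hεY hεW hδ hεX ⊢
  filter_upwards [condExp_sub ((hεYint.add hδint).sub hWα) hXγ m,
    condExp_sub (hεYint.add hδint) hWα m, condExp_add hεYint hδint m, hεY, hδ,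
    condExp_dotProduct_const_eq_zero hεWint hεW α,
    condExp_dotProduct_const_eq_zero hεXint hεX γ] with ω h₁ h₂ h₃ h₄ h₅ h₆ h₇
  simp [h₁, h₂, h₃, h₄, h₅, h₆, h₇]
end

section
/- Under the pre-treatment factor model with Γα = β and the pre-treatment proxy condition, the synthetic-control residual has zero conditional mean given the proxy: E[Y0 − ⟪W, α⟫ | σ(Z0)] = 0 almost surely. -/
open MeasureTheory Matrix ProbabilityTheory

/-- If `g` and an integrable `f` are conditionally independent given `k`, then conditioning `f` on
`(k, g)` is the same as conditioning it on `k`. -/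
theorem condExp_prodMk_ae_eq_of_condIndepFun
    {Ω γ δ : Type*} [MeasurableSpace Ω] [StandardBorelSpace Ω]
    {mγ : MeasurableSpace γ} {mδ : MeasurableSpace δ} [StandardBorelSpace δ] [Nonempty δ]
    {P : Measure Ω} [IsFiniteMeasure P] {k : Ω → γ} {g : Ω → δ} {f : Ω → ℝ}
    (hk : Measurable k) (hg : Measurable g) (hf : Measurable f) (hfint : Integrable f P)
    (h : CondIndepFun (mγ.comap k) hk.comap_le g f P) :
    P[f | MeasurableSpace.comap (fun ω => (k ω, g ω)) inferInstance] =ᵐ[P] P[f | mγ.comap k] := by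
  have hkg : Measurable fun ω => (k ω, g ω) := hk.prodMk hg
  have hker := ae_of_ae_map hkg.aemeasurable
    ((condIndepFun_iff_condDistrib_prod_ae_eq_prodMkRight hf hg hk).1 h)
  filter_upwards [hker, condExp_ae_eq_integral_condDistrib' hkg hfint,
    condExp_ae_eq_integral_condDistrib' hk hfint] with ω h₁ h₂ h₃
  rw [h₂, h₃, h₁, Kernel.prodMkRight_apply]

/-- A random variable with zero conditional mean given `k`, conditionally independent of `g` given
`k`, has zero conditional mean given `g`. -/
theorem condExp_ae_eq_zero_of_condIndepFun
    {Ω γ δ : Type*} [MeasurableSpace Ω] [StandardBorelSpace Ω]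
    {mγ : MeasurableSpace γ} {mδ : MeasurableSpace δ} [StandardBorelSpace δ] [Nonempty δ]
    {P : Measure Ω} [IsFiniteMeasure P] {k : Ω → γ} {g : Ω → δ} {f : Ω → ℝ}
    (hk : Measurable k) (hg : Measurable g) (hf : Measurable f) (hfint : Integrable f P)
    (h : CondIndepFun (mγ.comap k) hk.comap_le g f P) (hzero : P[f | mγ.comap k] =ᵐ[P] 0) :
    P[f | mδ.comap g] =ᵐ[P] 0 := by
  have hkg : Measurable fun ω => (k ω, g ω) := hk.prodMk hg
  have hle : mδ.comap g ≤ MeasurableSpace.comap (fun ω => (k ω, g ω)) inferInstance :=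
    (measurable_snd.comp (comap_measurable fun ω => (k ω, g ω))).comap_le
  refine (condExp_condExp_of_le hle hkg.comap_le).symm.trans ?_
  refine (condExp_congr_ae
    ((condExp_prodMk_ae_eq_of_condIndepFun hk hg hf hfint h).trans hzero)).trans ?_
  rw [condExp_zero]

/-- A fixed linear combination of integrable random variables with zero conditional mean has zero
conditional mean. -/
theorem condExp_dotProduct_ae_eq_zero {Ω ι : Type*} [Fintype ι] {m mΩ : MeasurableSpace Ω}
    {P : Measure Ω} {X : Ω → ι → ℝ} (a : ι → ℝ) (hX : ∀ i, Integrable (fun ω => X ω i) P)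
    (hzero : ∀ i, P[(fun ω => X ω i) | m] =ᵐ[P] 0) :
    P[(fun ω => X ω ⬝ᵥ a) | m] =ᵐ[P] 0 := by
  have hsum : (fun ω => X ω ⬝ᵥ a) = ∑ i, a i • fun ω => X ω i := by
    ext ω
    simp [dotProduct, mul_comm]
  rw [hsum]
  refine (condExp_finsetSum (fun i _ => (hX i).smul (a i)) m).trans ?_
  have hterm : ∀ i, P[a i • (fun ω => X ω i) | m] =ᵐ[P] 0 := fun i => by
    filter_upwards [condExp_smul (μ := P) (a i) (fun ω => X ω i) m, hzero i] with ω h₁ h₂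
    simp [h₁, h₂]
  filter_upwards [ae_all_iff.2 hterm] with ω hω
  simp [hω]

/-- Under the pre-treatment factor model with Γα = β and the pre-treatment proxy
condition, the synthetic-control residual has zero conditional mean given the proxy:
E[Y0 − ⟪W, α⟫ | σ(Z0)] = 0 almost surely. -/
theorem sc_residual_cond_mean_zero_proxy
    {Ω : Type*} [MeasurableSpace Ω] [StandardBorelSpace Ω] [Nonempty Ω]
    (P : Measure Ω) [IsProbabilityMeasure P]
    {F N d0 : ℕ}
    (lam : Ω → Fin F → ℝ) (β : Fin F → ℝ) (Γ : Matrix (Fin F) (Fin N) ℝ)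
    (Y0 : Ω → ℝ) (W : Ω → Fin N → ℝ) (εY : Ω → ℝ) (εW : Ω → Fin N → ℝ)
    (Z0 : Ω → Fin d0 → ℝ)
    (hlam : Measurable lam) (hZ0 : Measurable Z0)
    (hY0meas : Measurable Y0) (hWmeas : Measurable W)
    (hY0 : ∀ ω, Y0 ω = lam ω ⬝ᵥ β + εY ω)
    (hW : ∀ ω, W ω = Γ.transpose.mulVec (lam ω) + εW ω)
    (hεY : P[εY | MeasurableSpace.comap lam inferInstance] =ᵐ[P] 0)
    (hεW : ∀ i, P[(fun ω => εW ω i) | MeasurableSpace.comap lam inferInstance] =ᵐ[P] 0)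
    (hproxy : CondIndepFun (MeasurableSpace.comap lam inferInstance) hlam.comap_le
      Z0 (fun ω => (Y0 ω, W ω)) P)
    (hY0int : Integrable Y0 P) (hεYint : Integrable εY P)
    (hlamint : ∀ i, Integrable (fun ω => lam ω i) P)
    (hWint : ∀ i, Integrable (fun ω => W ω i) P)
    (hεWint : ∀ i, Integrable (fun ω => εW ω i) P)
    (α : Fin N → ℝ) (hα : Γ.mulVec α = β) :
    P[(fun ω => Y0 ω - W ω ⬝ᵥ α) | MeasurableSpace.comap Z0 inferInstance] =ᵐ[P] 0 := by
  have hres : (fun ω => Y0 ω - W ω ⬝ᵥ α) = εY - fun ω => εW ω ⬝ᵥ α := by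
    ext ω
    rw [Pi.sub_apply, hY0, hW, add_dotProduct, mulVec_transpose, ← dotProduct_mulVec, hα]
    ring
  have hεWα : Integrable (fun ω => εW ω ⬝ᵥ α) P :=
    integrable_finsetSum _ fun i _ => (hεWint i).mul_const (α i)
  have hφ : Measurable fun p : ℝ × (Fin N → ℝ) => p.1 - p.2 ⬝ᵥ α := by
    unfold dotProduct
    fun_prop
  refine condExp_ae_eq_zero_of_condIndepFun hlam hZ0 (hφ.comp (hY0meas.prodMk hWmeas)) ?_
    (hproxy.comp measurable_id hφ) ?_
  · exact hres ▸ hεYint.sub hεWα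
  · rw [hres]
    filter_upwards [condExp_sub hεYint hεWα (MeasurableSpace.comap lam inferInstance), hεY,
      condExp_dotProduct_ae_eq_zero α hεWint hεW] with ω h₁ h₂ h₃
    simp [h₁, h₂, h₃]
end

section
/- Under the completeness and nondegeneracy conditions, the weights satisfying the post-treatment proxy moment restriction are unique: if (α, γ) and (α̃, γ̃) in ℝ^N × ℝ^H both satisfy E[Y − ⟪W, α⟫ − ⟪X, γ⟫ | σ(Z0, Z1)] = 0 a.s. and E[Y − ⟪W, α̃⟫ − ⟪X, γ̃⟫ | σ(Z0, Z1)] = 0 a.s., then α = α̃ and γ = γ̃. -/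
open MeasureTheory Matrix

/-- Under the completeness and nondegeneracy conditions, the weights satisfying
the post-treatment proxy moment restriction are unique. -/
theorem sc_uniqueness_of_weights
    {Ω : Type*} [MeasurableSpace Ω] (P : Measure Ω) [IsProbabilityMeasure P]
    {N H d0 d1 : ℕ}
    (Y : Ω → ℝ) (W : Ω → Fin N → ℝ) (X : Ω → Fin H → ℝ)
    (Z0 : Ω → Fin d0 → ℝ) (Z1 : Ω → Fin d1 → ℝ)
    (hYint : Integrable Y P)
    (hWint : ∀ i, Integrable (fun ω => W ω i) P)
    (hXint : ∀ i, Integrable (fun ω => X ω i) P)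
    (hWmeas : Measurable W) (hXmeas : Measurable X)
    (hcomplete : ∀ V : Ω → ℝ, Integrable V P →
      Measurable[MeasurableSpace.comap (fun ω => (W ω, X ω)) inferInstance] V →
      P[V | MeasurableSpace.comap (fun ω => (Z0 ω, Z1 ω)) inferInstance] =ᵐ[P] 0 →
      V =ᵐ[P] 0)
    (hnondeg : ∀ (a : Fin N → ℝ) (b : Fin H → ℝ),
      (∀ᵐ ω ∂P, W ω ⬝ᵥ a + X ω ⬝ᵥ b = 0) → a = 0 ∧ b = 0)
    (α α' : Fin N → ℝ) (γ γ' : Fin H → ℝ)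
    (hmom : P[(fun ω => Y ω - W ω ⬝ᵥ α - X ω ⬝ᵥ γ) |
      MeasurableSpace.comap (fun ω => (Z0 ω, Z1 ω)) inferInstance] =ᵐ[P] 0)
    (hmom' : P[(fun ω => Y ω - W ω ⬝ᵥ α' - X ω ⬝ᵥ γ') |
      MeasurableSpace.comap (fun ω => (Z0 ω, Z1 ω)) inferInstance] =ᵐ[P] 0) :
    α = α' ∧ γ = γ' := by
  have integrable_dot : ∀ {n : ℕ} (U : Ω → Fin n → ℝ) (_ : ∀ i, Integrable (fun ω => U ω i) P)
      (a : Fin n → ℝ), Integrable (fun ω => U ω ⬝ᵥ a) P := fun U hU a =>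
    integrable_finsetSum _ fun i _ => (hU i).mul_const (a i)
  have hres : ∀ (a : Fin N → ℝ) (b : Fin H → ℝ),
      Integrable (fun ω => Y ω - W ω ⬝ᵥ a - X ω ⬝ᵥ b) P := fun a b =>
    (hYint.sub (integrable_dot W hWint a)).sub (integrable_dot X hXint b)
  have hdiff : (fun ω => W ω ⬝ᵥ (α' - α) + X ω ⬝ᵥ (γ' - γ)) =
      (fun ω => Y ω - W ω ⬝ᵥ α - X ω ⬝ᵥ γ) - fun ω => Y ω - W ω ⬝ᵥ α' - X ω ⬝ᵥ γ' := by
    ext ω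
    simp only [Pi.sub_apply, dotProduct_sub]
    ring
  have hmeas : Measurable fun p : (Fin N → ℝ) × (Fin H → ℝ) =>
      p.1 ⬝ᵥ (α' - α) + p.2 ⬝ᵥ (γ' - γ) := by
    unfold dotProduct
    fun_prop
  have hzero := hcomplete (fun ω => W ω ⬝ᵥ (α' - α) + X ω ⬝ᵥ (γ' - γ))
    ((integrable_dot W hWint _).add (integrable_dot X hXint _))
    (hmeas.comp (comap_measurable fun ω => (W ω, X ω))) (by
      rw [hdiff]
      filter_upwards [condExp_sub (hres α γ) (hres α' γ') _, hmom, hmom'] with ω h h₁ h₂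
      rw [h, Pi.sub_apply, h₁, h₂, Pi.zero_apply, sub_zero])
  obtain ⟨ha, hb⟩ := hnondeg _ _ hzero
  exact ⟨(sub_eq_zero.mp ha).symm, (sub_eq_zero.mp hb).symm⟩
end

section
/- Under the pre-treatment factor model with Γα = β and the pre-treatment proxy condition, the pre-treatment GMM moment function has mean zero at the true parameter: for every bounded measurable function g0 : ℝ^{d0} → ℝ, E[g0(Z0) · (Y0 − ⟪W, α⟫)] = 0. -/
open MeasureTheory Matrix ProbabilityTheory

/-- If `X` and `Y` are conditionally independent given `m'`, then the conditional expectation of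
their product is the product of their conditional expectations. -/
theorem condExp_mul_of_condIndepFun {Ω : Type*} {m' mΩ : MeasurableSpace Ω}
    [StandardBorelSpace Ω] {hm' : m' ≤ mΩ} {μ : Measure Ω} [IsFiniteMeasure μ] {X Y : Ω → ℝ}
    (h : CondIndepFun m' hm' X Y μ) (hX : Measurable X) (hY : Measurable Y)
    (hXint : Integrable X μ) (hYint : Integrable Y μ)
    (hXYint : Integrable (fun ω => X ω * Y ω) μ) :
    μ[fun ω => X ω * Y ω | m'] =ᵐ[μ] μ[X | m'] * μ[Y | m'] := by
  have hker := ae_of_ae_trim hm' ((condIndepFun_iff_map_prod_eq_prod_map_map hX hY).1 h)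
  filter_upwards [hker, condExp_ae_eq_integral_condExpKernel hm' hXYint,
    condExp_ae_eq_integral_condExpKernel hm' hXint,
    condExp_ae_eq_integral_condExpKernel hm' hYint] with ω hω hXYω hXω hYω
  have hmap : (condExpKernel μ m' ω).map (fun ω => (X ω, Y ω))
      = ((condExpKernel μ m' ω).map X).prod ((condExpKernel μ m' ω).map Y) := by
    rwa [Kernel.map_apply _ (hX.prodMk hY), Kernel.prod_apply, Kernel.map_apply _ hX,
      Kernel.map_apply _ hY] at hω
  have hindep : IndepFun X Y (condExpKernel μ m' ω) :=
    (indepFun_iff_map_prod_eq_prod_map_map hX.aemeasurable hY.aemeasurable).2 hmap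
  rw [Pi.mul_apply, hXYω, hXω, hYω]
  exact hindep.integral_fun_mul_eq_mul_integral hX.aestronglyMeasurable hY.aestronglyMeasurable

/-- A finite linear combination of integrable random variables with zero conditional expectation
has zero conditional expectation. -/
theorem condExp_sum_smul_eq_zero {Ω ι : Type*} [Fintype ι] {m mΩ : MeasurableSpace Ω}
    {μ : Measure Ω} {f : ι → Ω → ℝ} (hf : ∀ i, Integrable (f i) μ)
    (hcond : ∀ i, μ[f i | m] =ᵐ[μ] 0) (c : ι → ℝ) :
    μ[∑ i, c i • f i | m] =ᵐ[μ] 0 := by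
  have hterm : ∀ᵐ ω ∂μ, ∀ i, (μ[c i • f i | m]) ω = 0 := by
    refine ae_all_iff.2 fun i => ?_
    filter_upwards [condExp_smul (c i) (f i) m, hcond i] with ω h₁ h₂
    rw [h₁, Pi.smul_apply, h₂, Pi.zero_apply, smul_zero]
  filter_upwards [hterm, condExp_finsetSum (fun i _ => (hf i).smul (c i)) m] with ω h₁ h₂
  rw [h₂, Finset.sum_apply, Finset.sum_eq_zero fun i _ => h₁ i, Pi.zero_apply]

/-- Under the pre-treatment factor model with Γα = β and the pre-treatment proxy
condition, the pre-treatment GMM moment function has mean zero at the true parameter: for every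
bounded measurable g0 : ℝ^{d0} → ℝ, E[g0(Z0) · (Y0 − ⟪W, α⟫)] = 0. -/
theorem sc_pre_gmm_moment_zero
    {Ω : Type*} [MeasurableSpace Ω] [StandardBorelSpace Ω] [Nonempty Ω]
    (P : Measure Ω) [IsProbabilityMeasure P]
    {F N d0 : ℕ}
    (lam : Ω → Fin F → ℝ) (β : Fin F → ℝ) (Γ : Matrix (Fin F) (Fin N) ℝ)
    (Y0 : Ω → ℝ) (W : Ω → Fin N → ℝ) (εY : Ω → ℝ) (εW : Ω → Fin N → ℝ)
    (Z0 : Ω → Fin d0 → ℝ)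
    (hlam : Measurable lam) (hZ0 : Measurable Z0)
    (hY0meas : Measurable Y0) (hWmeas : Measurable W)
    (hY0 : ∀ ω, Y0 ω = lam ω ⬝ᵥ β + εY ω)
    (hW : ∀ ω, W ω = Γ.transpose.mulVec (lam ω) + εW ω)
    (hεY : P[εY | MeasurableSpace.comap lam inferInstance] =ᵐ[P] 0)
    (hεW : ∀ i, P[(fun ω => εW ω i) | MeasurableSpace.comap lam inferInstance] =ᵐ[P] 0)
    (hproxy : CondIndepFun (MeasurableSpace.comap lam inferInstance) hlam.comap_le
      Z0 (fun ω => (Y0 ω, W ω)) P)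
    (hY0int : Integrable Y0 P) (hεYint : Integrable εY P)
    (hlamint : ∀ i, Integrable (fun ω => lam ω i) P)
    (hWint : ∀ i, Integrable (fun ω => W ω i) P)
    (hεWint : ∀ i, Integrable (fun ω => εW ω i) P)
    (α : Fin N → ℝ) (hα : Γ.mulVec α = β) :
    ∀ g0 : (Fin d0 → ℝ) → ℝ, Measurable g0 → (∃ C, ∀ x, |g0 x| ≤ C) →
      ∫ ω, g0 (Z0 ω) * (Y0 ω - W ω ⬝ᵥ α) ∂P = 0 := by
  rintro g0 hg0 ⟨C, hC⟩
  have hresid : (fun ω => Y0 ω - W ω ⬝ᵥ α) = εY - ∑ i, α i • fun ω => εW ω i := by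
    ext ω
    have hfactor : (Γ.transpose.mulVec (lam ω)) ⬝ᵥ α = lam ω ⬝ᵥ β := by
      rw [mulVec_transpose, ← dotProduct_mulVec, hα]
    rw [hY0, hW, add_dotProduct, hfactor, add_sub_add_left_eq_sub]
    simp [dotProduct, mul_comm]
  have hsumint : Integrable (∑ i, α i • fun ω => εW ω i) P :=
    integrable_finsetSum' _ fun i _ => (hεWint i).smul (α i)
  have hDint : Integrable (fun ω => Y0 ω - W ω ⬝ᵥ α) P := hresid ▸ hεYint.sub hsumint
  have hDcond : P[fun ω => Y0 ω - W ω ⬝ᵥ α | MeasurableSpace.comap lam inferInstance] =ᵐ[P] 0 := by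
    rw [hresid]
    have hsum := condExp_sum_smul_eq_zero hεWint hεW α
    filter_upwards [condExp_sub hεYint hsumint _, hεY, hsum] with ω h₁ h₂ h₃
    rw [h₁, Pi.sub_apply, h₂, h₃, Pi.zero_apply, sub_zero]
  have hfun : Measurable fun p : ℝ × (Fin N → ℝ) => p.1 - p.2 ⬝ᵥ α := by
    unfold dotProduct
    fun_prop
  have hX : Measurable fun ω => g0 (Z0 ω) := hg0.comp hZ0
  have hD : Measurable fun ω => Y0 ω - W ω ⬝ᵥ α := hfun.comp (hY0meas.prodMk hWmeas)
  have hbound : ∀ᵐ ω ∂P, ‖g0 (Z0 ω)‖ ≤ C := ae_of_all _ fun ω => hC _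
  have hXint : Integrable (fun ω => g0 (Z0 ω)) P := .of_bound hX.aestronglyMeasurable C hbound
  have hindep : CondIndepFun (MeasurableSpace.comap lam inferInstance) hlam.comap_le
      (fun ω => g0 (Z0 ω)) (fun ω => Y0 ω - W ω ⬝ᵥ α) P := hproxy.comp hg0 hfun
  have hcond := condExp_mul_of_condIndepFun hindep hX hD hXint hDint
    (hDint.bdd_mul hX.aestronglyMeasurable hbound)
  rw [← integral_condExp hlam.comap_le]
  refine integral_eq_zero_of_ae ?_
  filter_upwards [hcond, hDcond] with ω h₁ h₂
  rw [h₁, Pi.mul_apply, h₂, Pi.zero_apply, mul_zero]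
end

section
/- If the outcome confounding bridge condition E[Y0 | σ(λ)] = E[h(W) | σ(λ)] a.s. holds and Z0 is conditionally independent of the pair (Y0, W) given σ(λ), then the nonparametric pre-treatment moment condition holds: E[Y0 − h(W) | σ(Z0)] = 0 almost surely. -/
open MeasureTheory ProbabilityTheory

namespace ProbabilityTheory

variable {Ω β γ : Type*} {m' : MeasurableSpace Ω} {mΩ : MeasurableSpace Ω} [StandardBorelSpace Ω]
  {hm' : m' ≤ mΩ} {μ : Measure Ω} [IsFiniteMeasure μ] {mβ : MeasurableSpace β}
  {mγ : MeasurableSpace γ} {f : Ω → β} {g : Ω → γ}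

/-- Conditionally independent random variables are almost surely independent under the
conditional expectation kernel. -/
theorem CondIndepFun.ae_indepFun_condExpKernel
    [MeasurableSpace.CountableOrCountablyGenerated Ω (β × γ)]
    (hfg : CondIndepFun m' hm' f g μ) (hf : Measurable f) (hg : Measurable g) :
    ∀ᵐ ω ∂μ, IndepFun f g (condExpKernel μ m' ω) := by
  filter_upwards [ae_of_ae_trim hm'
    ((condIndepFun_iff_map_prod_eq_prod_map_map hf hg).1 hfg)] with ω hω
  rw [indepFun_iff_map_prod_eq_prod_map_map hf.aemeasurable hg.aemeasurable]
  rwa [Kernel.map_apply _ (hf.prodMk hg), Kernel.prod_apply, Kernel.map_apply _ hf,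
    Kernel.map_apply _ hg] at hω

/-- If `g` is centered given `m'` and conditionally independent of `f` given `m'`, then `g` is
centered given `f`. -/
theorem CondIndepFun.condExp_comap_ae_eq_zero {g : Ω → ℝ}
    [MeasurableSpace.CountableOrCountablyGenerated Ω (β × ℝ)]
    (hfg : CondIndepFun m' hm' f g μ) (hf : Measurable f) (hg : Measurable g)
    (hg_int : Integrable g μ) (hg_zero : μ[g | m'] =ᵐ[μ] 0) :
    μ[g | mβ.comap f] =ᵐ[μ] 0 := by
  refine (ae_eq_condExp_of_forall_setIntegral_eq hf.comap_le hg_int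
    (fun _ _ _ ↦ integrableOn_zero) (fun A hA _ ↦ ?_) aestronglyMeasurable_zero).symm
  have hA' : MeasurableSet A := hf.comap_le A hA
  have hA_zero : μ[A.indicator g | m'] =ᵐ[μ] 0 := by
    filter_upwards [condExp_ae_eq_integral_condExpKernel hm' (hg_int.indicator hA'),
      condExp_ae_eq_integral_condExpKernel hm' hg_int, hg_zero,
      hfg.ae_indepFun_condExpKernel hf hg] with ω hAω hgω hω h_indep
    have h_mul : ∫ x in A, g x ∂condExpKernel μ m' ω
        = (condExpKernel μ m' ω).real A * ∫ x, g x ∂condExpKernel μ m' ω :=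
      Indep.setIntegral_eq_mul (f := id) hf.comap_le h_indep hg.aemeasurable hA
        aestronglyMeasurable_id
    rw [hAω, integral_indicator hA', h_mul, ← hgω, hω, Pi.zero_apply, mul_zero]
  rw [← integral_indicator (f := g) hA', ← integral_condExp (f := A.indicator g) hm',
    integral_congr_ae hA_zero]
  simp

end ProbabilityTheory

/-- If the outcome confounding bridge condition E[Y0 | σ(λ)] = E[h(W) | σ(λ)] a.s.
holds and Z0 is conditionally independent of the pair (Y0, W) given σ(λ), then the nonparametric
pre-treatment moment condition holds: E[Y0 − h(W) | σ(Z0)] = 0 almost surely. -/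
theorem nonparam_pre_moment_condition
    {Ω : Type*} [MeasurableSpace Ω] [StandardBorelSpace Ω] [Nonempty Ω]
    (P : Measure Ω) [IsProbabilityMeasure P]
    {F N d0 : ℕ}
    (Y0 : Ω → ℝ) (lam : Ω → Fin F → ℝ) (W : Ω → Fin N → ℝ) (Z0 : Ω → Fin d0 → ℝ)
    (h : (Fin N → ℝ) → ℝ)
    (hlam : Measurable lam) (hWmeas : Measurable W) (hZ0 : Measurable Z0)
    (hY0meas : Measurable Y0) (hh : Measurable h)
    (hY0int : Integrable Y0 P) (hhWint : Integrable (fun ω => h (W ω)) P)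
    (hbridge : P[Y0 | MeasurableSpace.comap lam inferInstance]
      =ᵐ[P] P[(fun ω => h (W ω)) | MeasurableSpace.comap lam inferInstance])
    (hproxy : CondIndepFun (MeasurableSpace.comap lam inferInstance) hlam.comap_le
      Z0 (fun ω => (Y0 ω, W ω)) P) :
    P[(fun ω => Y0 ω - h (W ω)) | MeasurableSpace.comap Z0 inferInstance] =ᵐ[P] 0 := by
  have hcenter :
      P[(fun ω => Y0 ω - h (W ω)) | MeasurableSpace.comap lam inferInstance] =ᵐ[P] 0 := by
    filter_upwards [condExp_sub hY0int hhWint (MeasurableSpace.comap lam inferInstance),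
      hbridge] with ω hsub hω
    exact hsub.trans (sub_eq_zero.2 hω)
  have hmeas : Measurable fun p : ℝ × (Fin N → ℝ) => p.1 - h p.2 := by fun_prop
  have hindep : CondIndepFun (MeasurableSpace.comap lam inferInstance) hlam.comap_le
      Z0 (fun ω => Y0 ω - h (W ω)) P := hproxy.comp measurable_id hmeas
  exact hindep.condExp_comap_ae_eq_zero hZ0 (by fun_prop) (hY0int.sub hhWint) hcenter
end

section
/- Under the pre-treatment factor model and the contaminated surrogate model with ΓΨ = Θ, the mean of the untreated contaminated surrogate vector is identified by the donors: E[(X0)_j] = E[(Ψᵀ W)_j] for every coordinate j, i.e., E[X0] = E[Ψᵀ W]. -/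
open MeasureTheory Matrix

/-- A function whose conditional expectation vanishes almost surely has integral zero. -/
theorem integral_eq_zero_of_condExp_eq_zero {Ω E : Type*} [NormedAddCommGroup E]
    [NormedSpace ℝ E] [CompleteSpace E] {m m₀ : MeasurableSpace Ω} {μ : Measure Ω} (hm : m ≤ m₀)
    [SigmaFinite (μ.trim hm)] {f : Ω → E} (hf : μ[f | m] =ᵐ[μ] 0) : ∫ ω, f ω ∂μ = 0 := by
  rw [← integral_condExp hm, integral_congr_ae hf]
  simp

/-- Under the pre-treatment factor model and the contaminated surrogate model with
ΓΨ = Θ, the mean of the untreated contaminated surrogate vector is identified by the donors: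
E[(X0)_j] = E[(Ψᵀ W)_j] for every coordinate j. -/
theorem sc_identification_contaminated_X0
    {Ω : Type*} [MeasurableSpace Ω] (P : Measure Ω) [IsProbabilityMeasure P]
    {F N H : ℕ}
    (lam : Ω → Fin F → ℝ) (β : Fin F → ℝ) (Γ : Matrix (Fin F) (Fin N) ℝ)
    (Θ : Matrix (Fin F) (Fin H) ℝ) (Ψ : Matrix (Fin N) (Fin H) ℝ)
    (Y0 : Ω → ℝ) (W : Ω → Fin N → ℝ) (X0 : Ω → Fin H → ℝ)
    (εY : Ω → ℝ) (εW : Ω → Fin N → ℝ) (εX : Ω → Fin H → ℝ)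
    (hlam : Measurable lam)
    (hY0 : ∀ ω, Y0 ω = lam ω ⬝ᵥ β + εY ω)
    (hW : ∀ ω, W ω = Γ.transpose.mulVec (lam ω) + εW ω)
    (hX0 : ∀ ω, X0 ω = Θ.transpose.mulVec (lam ω) + εX ω)
    (hεY : P[εY | MeasurableSpace.comap lam inferInstance] =ᵐ[P] 0)
    (hεW : ∀ i, P[(fun ω => εW ω i) | MeasurableSpace.comap lam inferInstance] =ᵐ[P] 0)
    (hεX : ∀ j, P[(fun ω => εX ω j) | MeasurableSpace.comap lam inferInstance] =ᵐ[P] 0)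
    (hY0int : Integrable Y0 P) (hεYint : Integrable εY P)
    (hlamint : ∀ i, Integrable (fun ω => lam ω i) P)
    (hWint : ∀ i, Integrable (fun ω => W ω i) P)
    (hX0int : ∀ j, Integrable (fun ω => X0 ω j) P)
    (hεWint : ∀ i, Integrable (fun ω => εW ω i) P)
    (hεXint : ∀ j, Integrable (fun ω => εX ω j) P)
    (hΨ : Γ * Ψ = Θ) :
    ∀ j, ∫ ω, X0 ω j ∂P = ∫ ω, Ψ.transpose.mulVec (W ω) j ∂P := by
  intro j
  have hεX0 : ∫ ω, εX ω j ∂P = 0 := integral_eq_zero_of_condExp_eq_zero hlam.comap_le (hεX j)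
  have hεW0 (i) : ∫ ω, εW ω i ∂P = 0 := integral_eq_zero_of_condExp_eq_zero hlam.comap_le (hεW i)
  have hdonor (ω) : Ψ.transpose.mulVec (W ω) j
      = X0 ω j - εX ω j + ∑ i, Ψ i j * εW ω i := by
    rw [hW, hX0, ← hΨ, mulVec_add, mulVec_mulVec, transpose_mul]
    simp [mulVec, dotProduct]
  have hsum : ∫ ω, ∑ i, Ψ i j * εW ω i ∂P = 0 := by
    rw [integral_finsetSum _ fun i _ => (hεWint i).const_mul (Ψ i j)]
    simp [integral_const_mul, hεW0]
  have hdiff : Integrable (fun ω => X0 ω j - εX ω j) P := (hX0int j).sub (hεXint j)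
  have hsumint : Integrable (fun ω => ∑ i, Ψ i j * εW ω i) P :=
    integrable_finsetSum _ fun i _ => (hεWint i).const_mul (Ψ i j)
  simp_rw [hdonor]
  rw [integral_add hdiff hsumint,
    integral_sub (hX0int j) (hεXint j), hεX0, hsum, sub_zero, add_zero]
end
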